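/- arXiv:1512.03084 — 2 statements merged into one kernel-verified Lean document; each statement's English description precedes it below -/
import Mathlib

section
/- Let K ≥ 1, let E ≥ 1, let k, j : Fin E → {1,…,K} be degree label functions, let Q : Fin K × Fin K → ℝ be nonnegative with ACG normalization C > 0, and let m⁻_{j'} = #{ℓ : j(ℓ) = j'}, m⁺_{k'} = #{ℓ : k(ℓ) = k'}. Fix (k₀, j₀) with m⁻_{j₀} ≥ 1 and m⁺_{k₀} ≥ 1, and suppose ∫_{[0,2π]^{2K}} exp(H(−iu; (m⁻,m⁺))) du ≠ 0. Then the expectation of the edge-type count e_{k₀j₀} under the ACG wiring measure satisfies 𝔼[e_{k₀j₀}] = Q(k₀,j₀) · ∫_{[0,2π]^{2K}} exp(H(−iu; (m⁻ − 1_{j₀}, m⁺ − 1_{k₀}))) du / ∫_{[0,2π]^{2K}} exp(H(−iu; (m⁻, m⁺))) du. -/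
open scoped BigOperators Classical

open MeasureTheory

/-- The weight of a wiring `(σ, τ)`. -/
noncomputable def wiringWeight (K E : ℕ) (k j : Fin E → Fin K) (Q : Fin K × Fin K → ℝ)
    (σ τ : Equiv.Perm (Fin E)) : ℝ :=
  ∏ ℓ : Fin E, Q (k (σ ℓ), j (τ ℓ))

/-- The ACG normalization constant `C = ∑_{σ,τ} w(σ,τ)`. -/
noncomputable def Cnorm (K E : ℕ) (k j : Fin E → Fin K) (Q : Fin K × Fin K → ℝ) : ℝ :=
  ∑ σ : Equiv.Perm (Fin E), ∑ τ : Equiv.Perm (Fin E), wiringWeight K E k j Q σ τ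

/-- The number of edges of type `(k', j')` in the wiring `(σ, τ)`. -/
def edgeTypeCount (K E : ℕ) (k j : Fin E → Fin K) (σ τ : Equiv.Perm (Fin E))
    (k' j' : Fin K) : ℕ :=
  (Finset.univ.filter fun ℓ => k (σ ℓ) = k' ∧ j (τ ℓ) = j').card

/-- The number of stubs with degree label `d`. -/
def stubCount (K E : ℕ) (f : Fin E → Fin K) (d : Fin K) : ℕ :=
  (Finset.univ.filter fun ℓ => f ℓ = d).card

/-- Expectation of the edge-type count `e_{k₀j₀}` under the ACG wiring measure. -/
noncomputable def expectEdge (K E : ℕ) (k j : Fin E → Fin K) (Q : Fin K × Fin K → ℝ)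
    (k₀ j₀ : Fin K) : ℝ :=
  (∑ σ : Equiv.Perm (Fin E), ∑ τ : Equiv.Perm (Fin E),
      (edgeTypeCount K E k j σ τ k₀ j₀ : ℝ) * wiringWeight K E k j Q σ τ) / Cnorm K E k j Q

/-- The complex `H` function: `H(α; e) = ∑_{j,k} Q(k,j) exp(α⁻_j + α⁺_k) − α·e`. -/
noncomputable def Hcomplex (K : ℕ) (Q : Fin K × Fin K → ℝ)
    (α : (Fin K → ℂ) × (Fin K → ℂ)) (e : (Fin K → ℝ) × (Fin K → ℝ)) : ℂ :=
  (∑ j : Fin K, ∑ k : Fin K, (Q (k, j) : ℂ) * Complex.exp (α.1 j + α.2 k)) -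
    ((∑ j : Fin K, α.1 j * (e.1 j : ℂ)) + ∑ k : Fin K, α.2 k * (e.2 k : ℂ))

/-- The box `[0, 2π]^{2K}`. -/
def intBox (K : ℕ) : Set ((Fin K → ℝ) × (Fin K → ℝ)) :=
  Set.Icc (0 : Fin K → ℝ) (fun _ => 2 * Real.pi) ×ˢ
    Set.Icc (0 : Fin K → ℝ) (fun _ => 2 * Real.pi)

noncomputable def Asum (K n : ℕ) (Q : Fin K × Fin K → ℝ) (e1 e2 : Fin K → ℕ) : ℝ :=
  ∑ g : Fin n → Fin K, ∑ h : Fin n → Fin K,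
    if stubCount K n g = e2 ∧ stubCount K n h = e1 then ∏ l, Q (g l, h l) else 0

lemma exists_perm_of_count (K E : ℕ) (k g : Fin E → Fin K)
    (h : stubCount K E g = stubCount K E k) : ∃ σ : Equiv.Perm (Fin E), k ∘ σ = g := by
  have : ∀ d, Nonempty ({x // g x = d} ≃ {x // k x = d}) := by
    intro d
    have := congrFun h d
    unfold stubCount at this
    refine ⟨Fintype.equivOfCardEq ?_⟩
    rw [Fintype.card_subtype, Fintype.card_subtype]
    convert this
  let f := fun d => (this d).some
  refine ⟨Equiv.ofFiberEquiv (f := g) (g := k) f, ?_⟩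
  funext x
  exact Equiv.ofFiberEquiv_map f x

lemma stubCount_comp (K E : ℕ) (k : Fin E → Fin K) (σ : Equiv.Perm (Fin E)) :
    stubCount K E (k ∘ σ) = stubCount K E k := by
  funext d
  unfold stubCount
  simp only [Finset.card_filter]
  exact Equiv.sum_comp σ (fun l => if k l = d then 1 else 0)

lemma sum_perm (K E : ℕ) (k : Fin E → Fin K) : ∃ N : ℕ, 
    ∀ F : (Fin E → Fin K) → ℝ, ∑ σ : Equiv.Perm (Fin E), F (k ∘ σ) =
      N * ∑ g : Fin E → Fin K, if stubCount K E g = stubCount K E k then F g else 0 := by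
  refine ⟨(Finset.univ.filter fun σ : Equiv.Perm (Fin E) => k ∘ σ = k).card, fun F => ?_⟩
  rw [← Finset.sum_fiberwise Finset.univ (fun σ : Equiv.Perm (Fin E) => k ∘ σ), Finset.mul_sum]
  refine Finset.sum_congr rfl fun g _ => ?_
  rw [Finset.sum_congr rfl (g := fun _ => F g) (by
    intro σ hσ
    rw [(Finset.mem_filter.1 hσ).2])]
  rw [Finset.sum_const, nsmul_eq_mul]
  split_ifs with h
  · congr 2
    obtain ⟨σ₀, rfl⟩ := exists_perm_of_count K E k g h
    refine Finset.card_bij (fun σ _ => σ * σ₀⁻¹) ?_ ?_ ?_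
    · intro σ hσ
      simp only [Finset.mem_filter, Finset.mem_univ, true_and] at hσ ⊢
      funext x
      have := congrFun hσ (σ₀⁻¹ x)
      simpa using this
    · intro a _ b _ hab
      exact mul_right_cancel hab
    · intro b hb
      refine ⟨b * σ₀, ?_, by simp⟩
      simp only [Finset.mem_filter, Finset.mem_univ, true_and] at hb ⊢
      funext x
      have := congrFun hb (σ₀ x)
      simpa using this
  · rw [Finset.filter_false_of_mem, Finset.card_empty]
    · simp
    · rintro σ _ rfl
      exact h (stubCount_comp K E k σ)

lemma stubCount_insertNth (K n : ℕ) (l : Fin (n+1)) (a : Fin K) (g : Fin n → Fin K) (d : Fin K) :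
    stubCount K (n+1) (Fin.insertNth (α := fun _ => Fin K) l a g) d = (if d = a then 1 else 0) + stubCount K n g d := by
  unfold stubCount
  simp only [Finset.card_filter]
  rw [Fin.sum_univ_succAbove _ l]
  simp [eq_comm]

lemma stub_iff (K n : ℕ) (l : Fin (n+1)) (a : Fin K) (g : Fin n → Fin K) (m : Fin K → ℕ) (hm : 1 ≤ m a) :
    stubCount K (n+1) (Fin.insertNth (α := fun _ => Fin K) l a g) = m ↔ 
      stubCount K n g = fun d => m d - if d = a then 1 else 0 := by
  simp only [funext_iff, stubCount_insertNth]
  refine forall_congr' fun d => ?_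
  split_ifs with h
  · subst h; omega
  · omega

lemma sum_insert {K n : ℕ} (l : Fin (n+1)) (a : Fin K) (F : (Fin (n+1) → Fin K) → ℝ) :
    ∑ g, (if g l = a then F g else 0) = 
      ∑ g : Fin n → Fin K, F (Fin.insertNth (α := fun _ => Fin K) l a g) := by
  rw [← Equiv.sum_comp (Fin.insertNthEquiv (fun _ => Fin K) l), Fintype.sum_prod_type]
  simp [Fin.insertNthEquiv]

lemma Asum_step (K n : ℕ) (Q : Fin K × Fin K → ℝ) (e1 e2 : Fin K → ℕ) (k₀ j₀ : Fin K)
    (h1 : 1 ≤ e1 j₀) (h2 : 1 ≤ e2 k₀) :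
    (∑ g : Fin (n+1) → Fin K, ∑ h : Fin (n+1) → Fin K,
    if stubCount K (n+1) g = e2 ∧ stubCount K (n+1) h = e1 then 
      ((Finset.univ.filter fun ℓ => g ℓ = k₀ ∧ h ℓ = j₀).card : ℝ) * ∏ l, Q (g l, h l) else 0) =
    (n+1) * (Q (k₀, j₀) * Asum K n Q (fun d => e1 d - if d = j₀ then 1 else 0)
       (fun d => e2 d - if d = k₀ then 1 else 0)) := by
  have key : ∀ l : Fin (n+1), 
    (∑ g : Fin (n+1) → Fin K, if g l = k₀ then (∑ h : Fin (n+1) → Fin K, if h l = j₀ then 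
    (if stubCount K (n+1) g = e2 ∧ stubCount K (n+1) h = e1 then ∏ l, Q (g l, h l) else 0) else 0) else 0) =
     Q (k₀, j₀) * Asum K n Q (fun d => e1 d - if d = j₀ then 1 else 0)
       (fun d => e2 d - if d = k₀ then 1 else 0) := by
    intro l
    rw [sum_insert l k₀]
    unfold Asum
    rw [Finset.mul_sum]
    refine Finset.sum_congr rfl fun g _ => ?_
    rw [sum_insert l j₀, Finset.mul_sum]
    refine Finset.sum_congr rfl fun h _ => ?_
    simp only [stub_iff _ _ _ _ _ _ h1, stub_iff _ _ _ _ _ _ h2]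
    rw [Fin.prod_univ_succAbove _ l]
    simp
  have := Finset.sum_congr (rfl : (Finset.univ : Finset (Fin (n+1))) = _) (fun l _ => key l)
  rw [Finset.sum_const, Finset.card_univ, Fintype.card_fin, nsmul_eq_mul, Finset.sum_comm] at this
  push_cast at this
  rw [← this]
  refine Finset.sum_congr rfl fun g _ => ?_
  have h3 : ∀ l : Fin (n+1), (if g l = k₀ then (∑ h : Fin (n+1) → Fin K, if h l = j₀ then 
    (if stubCount K (n+1) g = e2 ∧ stubCount K (n+1) h = e1 then ∏ l, Q (g l, h l) else 0) else 0) else 0)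
    = ∑ h : Fin (n+1) → Fin K, if g l = k₀ ∧ h l = j₀ then 
    (if stubCount K (n+1) g = e2 ∧ stubCount K (n+1) h = e1 then ∏ l, Q (g l, h l) else 0) else 0 := by
    intro l
    by_cases h : g l = k₀ <;> simp [h]
  simp only [h3]
  rw [Finset.sum_comm]
  refine Finset.sum_congr rfl fun h _ => ?_
  rw [Finset.card_filter]
  by_cases hh : stubCount K (n+1) g = e2 ∧ stubCount K (n+1) h = e1
  · simp only [if_pos hh]
    push_cast
    rw [Finset.sum_mul]
    simp
  · simp [if_neg hh]

lemma int1 (z : ℤ) : ∫ x in Set.Icc (0:ℝ) (2 * Real.pi), Complex.exp (Complex.I * z * x) = 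
    if z = 0 then (2 * Real.pi : ℂ) else 0 := by
  rw [integral_Icc_eq_integral_Ioc, ← intervalIntegral.integral_of_le (by positivity)]
  split_ifs with h
  · subst h; simp
  · rw [integral_exp_mul_complex (by simp [h])]
    have : Complex.exp (Complex.I * z * (2 * Real.pi : ℝ)) = 1 := by
      rw [Complex.exp_eq_one_iff]; exact ⟨z, by push_cast; ring⟩
    rw [this]; simp

lemma intK (K : ℕ) (z : Fin K → ℤ) :
    ∫ u in Set.Icc (0 : Fin K → ℝ) (fun _ => 2 * Real.pi), ∏ d, Complex.exp (Complex.I * z d * u d) = 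
    if z = 0 then (2 * Real.pi : ℂ)^K else 0 := by
  rw [← Set.pi_univ_Icc, volume_pi, Measure.restrict_pi_pi,
    integral_fintype_prod_eq_prod (𝕜 := ℂ) (fun d x => Complex.exp (Complex.I * z d * (x:ℝ)))]
  simp only [Pi.zero_apply, int1]
  split_ifs with h
  · subst h; simp
  · obtain ⟨d, hd⟩ := Function.ne_iff.1 h
    exact Finset.prod_eq_zero (Finset.mem_univ d) (if_neg hd)

lemma int2K (K : ℕ) (z w : Fin K → ℤ) :
    ∫ u in intBox K, (∏ d, Complex.exp (Complex.I * z d * u.1 d)) * 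
       ∏ d, Complex.exp (Complex.I * w d * u.2 d) = 
    if w = 0 ∧ z = 0 then (2 * Real.pi : ℂ)^(2*K) else 0 := by
  unfold intBox
  rw [Measure.volume_eq_prod, setIntegral_prod_mul (fun u : Fin K → ℝ => ∏ d, Complex.exp (Complex.I * z d * u d))
    (fun u : Fin K → ℝ => ∏ d, Complex.exp (Complex.I * w d * u d)), intK, intK]
  split_ifs <;> simp_all [two_mul, pow_add]

lemma stub_sum {K n : ℕ} (g : Fin n → Fin K) (v : Fin K → ℂ) : ∑ l, v (g l) = ∑ d, (stubCount K n g d : ℂ) * v d := by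
  rw [← Finset.sum_fiberwise Finset.univ g]
  refine Finset.sum_congr rfl fun d _ => ?_
  rw [Finset.sum_congr rfl (g := fun _ => v d) (by
    intro σ hσ
    rw [(Finset.mem_filter.1 hσ).2]), Finset.sum_const, nsmul_eq_mul]
  unfold stubCount
  congr!

noncomputable def Sf (K : ℕ) (Q : Fin K × Fin K → ℝ) (u : (Fin K → ℝ) × (Fin K → ℝ)) : ℂ :=
  ∑ p : Fin K × Fin K, (Q p : ℂ) * Complex.exp (-Complex.I * u.1 p.2 + -Complex.I * u.2 p.1)

noncomputable def Lf (K : ℕ) (e1 e2 : Fin K → ℕ) (u : (Fin K → ℝ) × (Fin K → ℝ)) : ℂ :=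
  Complex.exp (Complex.I * ((∑ d, u.1 d * e1 d : ℝ) + (∑ d, u.2 d * e2 d : ℝ)))

lemma isCompact_box (K : ℕ) : IsCompact (intBox K) := isCompact_Icc.prod isCompact_Icc

lemma term_int (K n : ℕ) (Q : Fin K × Fin K → ℝ) (e1 e2 : Fin K → ℕ) :
    ∫ u in intBox K, Sf K Q u ^ n * Lf K e1 e2 u = (2 * Real.pi : ℂ)^(2*K) * (Asum K n Q e1 e2 : ℂ) := by
  have h1 : ∀ u, Sf K Q u ^ n * Lf K e1 e2 u = ∑ p : Fin n → Fin K × Fin K, 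
      (∏ l, (Q (p l) : ℂ)) * ((∏ d, Complex.exp (Complex.I * ((e1 d - stubCount K n (fun l => (p l).2) d : ℤ) : ℂ) * u.1 d)) * 
       ∏ d, Complex.exp (Complex.I * ((e2 d - stubCount K n (fun l => (p l).1) d : ℤ) : ℂ) * u.2 d)) := by
    intro u
    unfold Sf Lf
    rw [Fintype.sum_pow, Finset.sum_mul]
    refine Finset.sum_congr rfl fun p _ => ?_
    rw [Finset.prod_mul_distrib, mul_assoc]
    congr 1
    rw [← Complex.exp_sum, ← Complex.exp_sum, ← Complex.exp_sum, ← Complex.exp_add, ← Complex.exp_add]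
    congr 1
    rw [Finset.sum_add_distrib, stub_sum (fun l => (p l).2) (fun d => -Complex.I * u.1 d),
      stub_sum (fun l => (p l).1) (fun d => -Complex.I * u.2 d)]
    push_cast
    rw [mul_add, Finset.mul_sum, Finset.mul_sum, add_add_add_comm, ← Finset.sum_add_distrib, ← Finset.sum_add_distrib]
    congr 1 <;> exact Finset.sum_congr rfl fun d _ => by ring
  simp only [h1]
  rw [integral_finsetSum]
  · simp only [integral_const_mul]
    have := fun p : Fin n → Fin K × Fin K => int2K K (fun d => e1 d - stubCount K n (fun l => (p l).2) d) (fun d => e2 d - stubCount K n (fun l => (p l).1) d)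
    simp only [this]
    unfold Asum
    rw [← Equiv.sum_comp (Equiv.arrowProdEquivProdArrow (Fin n) (fun _ => Fin K) (fun _ => Fin K)).symm, Fintype.sum_prod_type]
    push_cast
    rw [Finset.mul_sum]
    refine Finset.sum_congr rfl fun g _ => ?_
    rw [Finset.mul_sum]
    refine Finset.sum_congr rfl fun h _ => ?_
    have e : ∀ (e : Fin K → ℕ) (g : Fin n → Fin K), ((fun d => (e d : ℤ) - stubCount K n g d) = 0) ↔ stubCount K n g = e := by
      intro e g
      simp only [funext_iff, Pi.zero_apply]
      exact forall_congr' fun d => by omega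
    simp only [e, Equiv.arrowProdEquivProdArrow, Equiv.coe_fn_symm_mk]
    split_ifs <;> simp [mul_comm]
  · intro p _
    refine ContinuousOn.integrableOn_compact (isCompact_box K) (Continuous.continuousOn ?_)
    fun_prop

lemma sum_stub (K n : ℕ) (g : Fin n → Fin K) : ∑ d, stubCount K n g d = n := by
  unfold stubCount
  have := Finset.card_eq_sum_card_fiberwise (s := Finset.univ) (t := Finset.univ) (f := g) (by simp)
  rw [Finset.card_univ, Fintype.card_fin] at this
  exact this.symm

lemma Asum_zero (K n : ℕ) (Q : Fin K × Fin K → ℝ) (e1 e2 : Fin K → ℕ) (h : ∑ d, e1 d ≠ n) : Asum K n Q e1 e2 = 0 := by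
  unfold Asum
  refine Finset.sum_eq_zero fun g _ => Finset.sum_eq_zero fun f _ => if_neg ?_
  rintro ⟨_, rfl⟩
  exact h (sum_stub K n f)

lemma exp_int (K n : ℕ) (Q : Fin K × Fin K → ℝ) (e1 e2 : Fin K → ℕ) (h : ∑ d, e1 d = n) :
    ∫ u in intBox K, Complex.exp (Sf K Q u) * Lf K e1 e2 u = (2 * Real.pi : ℂ)^(2*K) * (Asum K n Q e1 e2 : ℂ) / (n.factorial : ℂ) := by
  have hcS : Continuous (Sf K Q) := by unfold Sf; fun_prop
  have hcL : Continuous (Lf K e1 e2) := by unfold Lf; fun_prop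
  have hL : ∀ u, ‖Lf K e1 e2 u‖ = 1 := by
    intro u; unfold Lf
    rw [mul_comm, ← Complex.ofReal_add, Complex.norm_exp_ofReal_mul_I]
  have hS : ∀ u, ‖Sf K Q u‖ ≤ ∑ p, |Q p| := by
    intro u; unfold Sf
    refine (norm_sum_le _ _).trans (Finset.sum_le_sum fun p _ => ?_)
    rw [norm_mul, show (-Complex.I * u.1 p.2 + -Complex.I * u.2 p.1 : ℂ) = ((-u.1 p.2 - u.2 p.1 : ℝ) : ℂ) * Complex.I by push_cast; ring,
      Complex.norm_exp_ofReal_mul_I]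
    simp
  have hfin : IsFiniteMeasure (volume.restrict (intBox K)) := 
    ⟨by simpa using (isCompact_box K).measure_lt_top⟩
  have := hasSum_integral_of_dominated_convergence (μ := volume.restrict (intBox K)) 
    (F := fun (n : ℕ) u => Sf K Q u ^ n * Lf K e1 e2 u / (n.factorial : ℂ)) (f := fun u => Complex.exp (Sf K Q u) * Lf K e1 e2 u)
    (fun n _ => (∑ p, |Q p|)^n / n.factorial) 
    (fun n => by exact Continuous.aestronglyMeasurable (by fun_prop))
    (fun n => Filter.Eventually.of_forall fun u => by
      rw [norm_div, norm_mul, hL, norm_pow, mul_one, Complex.norm_natCast]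
      gcongr
      exact hS u)
    (Filter.Eventually.of_forall fun u => Real.summable_pow_div_factorial _)
    (integrable_const _)
    (Filter.Eventually.of_forall fun u => by
      have := (NormedSpace.expSeries_div_hasSum_exp (𝔸 := ℂ) (Sf K Q u)).mul_right (Lf K e1 e2 u)
      rw [← Complex.exp_eq_exp_ℂ] at this
      simpa only [div_mul_eq_mul_div] using this)
  simp only [integral_div, term_int] at this
  refine this.unique ?_
  convert hasSum_single n ?_ using 1
  intro n' hn'
  rw [Asum_zero K n' Q e1 e2 (by omega)]
  simp

lemma exp_H (K n : ℕ) (Q : Fin K × Fin K → ℝ) (e1 e2 : Fin K → ℕ) (h : ∑ d, e1 d = n) :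
    (∫ u in intBox K,
        Complex.exp (Hcomplex K Q (fun j' => -Complex.I * (u.1 j' : ℝ),
            fun k' => -Complex.I * (u.2 k' : ℝ))
          (fun j' => (e1 j' : ℝ), fun k' => (e2 k' : ℝ)))) = 
      (2 * Real.pi : ℂ)^(2*K) * (Asum K n Q e1 e2 : ℂ) / (n.factorial : ℂ) := by
  rw [← exp_int K n Q e1 e2 h]
  refine integral_congr_ae (Filter.Eventually.of_forall fun u => ?_)
  unfold Hcomplex Sf Lf
  simp only
  rw [← Complex.exp_add, Fintype.sum_prod_type, Finset.sum_comm, sub_eq_add_neg]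
  congr 2
  push_cast
  rw [neg_add, mul_add, Finset.mul_sum, Finset.mul_sum, ← Finset.sum_neg_distrib, ← Finset.sum_neg_distrib]
  congr 1 <;> exact Finset.sum_congr rfl fun d _ => by ring

lemma sum_two (K E : ℕ) (k j : Fin E → Fin K) : ∃ N : ℝ, ∀ F : (Fin E → Fin K) → (Fin E → Fin K) → ℝ,
    ∑ σ : Equiv.Perm (Fin E), ∑ τ : Equiv.Perm (Fin E), F (k ∘ σ) (j ∘ τ) = 
      N * ∑ g, ∑ h, if stubCount K E g = stubCount K E k ∧ stubCount K E h = stubCount K E j then F g h else 0 := by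
  obtain ⟨N, hN⟩ := sum_perm K E k
  obtain ⟨M, hM⟩ := sum_perm K E j
  refine ⟨N * M, fun F => ?_⟩
  simp only [hM]
  rw [hN (fun g => M * ∑ h, if stubCount K E h = stubCount K E j then F g h else 0), mul_assoc]
  congr 1
  rw [Finset.mul_sum]
  refine Finset.sum_congr rfl fun g _ => ?_
  by_cases h : stubCount K E g = stubCount K E k <;> simp [h]

/-- The expected edge-type count satisfies
`𝔼[e_{k₀j₀}] = Q(k₀,j₀) · ∫ exp(H(−iu; m − δ_{j₀k₀})) du / ∫ exp(H(−iu; m)) du`. -/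
theorem stmt11 (K : ℕ) (hK : 1 ≤ K) (E : ℕ) (hE : 1 ≤ E) (k j : Fin E → Fin K)
    (Q : Fin K × Fin K → ℝ) (hQ : ∀ p, 0 ≤ Q p) (hC : 0 < Cnorm K E k j Q)
    (k₀ j₀ : Fin K) (hm : 1 ≤ stubCount K E j j₀) (hp : 1 ≤ stubCount K E k k₀)
    (hint : (∫ u in intBox K,
        Complex.exp (Hcomplex K Q (fun j' => -Complex.I * (u.1 j' : ℝ),
            fun k' => -Complex.I * (u.2 k' : ℝ))
          (fun j' => (stubCount K E j j' : ℝ), fun k' => (stubCount K E k k' : ℝ)))) ≠ 0) :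
    ((expectEdge K E k j Q k₀ j₀ : ℝ) : ℂ) =
      (Q (k₀, j₀) : ℂ) *
        (∫ u in intBox K,
          Complex.exp (Hcomplex K Q (fun j' => -Complex.I * (u.1 j' : ℝ),
              fun k' => -Complex.I * (u.2 k' : ℝ))
            (fun j' => ((stubCount K E j j' - if j' = j₀ then 1 else 0 : ℕ) : ℝ),
              fun k' => ((stubCount K E k k' - if k' = k₀ then 1 else 0 : ℕ) : ℝ)))) /
        (∫ u in intBox K,
          Complex.exp (Hcomplex K Q (fun j' => -Complex.I * (u.1 j' : ℝ),
              fun k' => -Complex.I * (u.2 k' : ℝ))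
            (fun j' => (stubCount K E j j' : ℝ), fun k' => (stubCount K E k k' : ℝ)))) := by
  obtain ⟨n, rfl⟩ : ∃ n, E = n + 1 := ⟨E - 1, by omega⟩
  have hs : ∑ d, (stubCount K (n+1) j d - if d = j₀ then 1 else 0) = n := by
    have h1 := sum_stub K (n+1) j
    have h2 : ∑ d, (stubCount K (n+1) j d - if d = j₀ then 1 else 0) + ∑ d, (if d = j₀ then 1 else 0)
        = ∑ d, stubCount K (n+1) j d := by
      rw [← Finset.sum_add_distrib]
      refine Finset.sum_congr rfl fun d _ => ?_
      split_ifs with h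
      · subst h; omega
      · omega
    rw [Finset.sum_ite_eq' Finset.univ j₀] at h2
    simp only [Finset.mem_univ, if_true] at h2
    omega
  have I1 := exp_H K (n+1) Q (stubCount K (n+1) j) (stubCount K (n+1) k) (sum_stub K (n+1) j)
  have I2 := exp_H K n Q (fun d => stubCount K (n+1) j d - if d = j₀ then 1 else 0)
    (fun d => stubCount K (n+1) k d - if d = k₀ then 1 else 0) hs
  obtain ⟨N, hN⟩ := sum_two K (n+1) k j
  have hCN : Cnorm K (n+1) k j Q = N * Asum K (n+1) Q (stubCount K (n+1) j) (stubCount K (n+1) k) :=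
    hN (fun g h => ∏ l, Q (g l, h l))
  have hEN := hN (fun g h => ((Finset.univ.filter fun ℓ => g ℓ = k₀ ∧ h ℓ = j₀).card : ℝ) *
    ∏ l, Q (g l, h l))
  rw [Asum_step K n Q _ _ k₀ j₀ hm hp] at hEN
  have hE2 : expectEdge K (n+1) k j Q k₀ j₀ = (N * ((n+1) * (Q (k₀, j₀) *
      Asum K n Q (fun d => stubCount K (n+1) j d - if d = j₀ then 1 else 0)
       (fun d => stubCount K (n+1) k d - if d = k₀ then 1 else 0)))) / Cnorm K (n+1) k j Q := by
    unfold expectEdge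
    rw [← hEN]
    congr 1
  rw [hCN] at hE2 hC
  have hN0 : N ≠ 0 := by rintro rfl; simp at hC
  have hA0 : Asum K (n+1) Q (stubCount K (n+1) j) (stubCount K (n+1) k) ≠ 0 := by
    intro h; rw [h] at hC; simp at hC
  rw [I1, I2, hE2]
  generalize Asum K (n+1) Q (stubCount K (n+1) j) (stubCount K (n+1) k) = a at *
  generalize Asum K n Q _ _ = b at *
  have hNc : (N : ℂ) ≠ 0 := by exact_mod_cast hN0
  have hac : (a : ℂ) ≠ 0 := by exact_mod_cast hA0
  have hpi : (Real.pi : ℂ) ≠ 0 := by exact_mod_cast Real.pi_ne_zero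
  have hf : (n.factorial : ℂ) ≠ 0 := by exact_mod_cast n.factorial_ne_zero
  have hn1 : (n + 1 : ℂ) ≠ 0 := by exact_mod_cast n.succ_ne_zero
  rw [Nat.factorial_succ]
  push_cast
  field_simp
end

section
/- Let K ≥ 1 and let Q : Fin K × Fin K → ℝ satisfy Q(k,j) > 0 for all k,j and ∑_{j,k} Q(k,j) = 1. Define marginals Q⁻_j = ∑_k Q(k,j) and Q⁺_k = ∑_j Q(k,j). Then: (i) the double vector α = 0 is the unique critical point of H(·; (Q⁻, Q⁺)) with 𝟏̃·α = 0, and H(0; (Q⁻, Q⁺)) = 1. (ii) If for each E ≥ 1, k_E, j_E : Fin E → {1,…,K} are degree label functions whose margins e(E) satisfy e(E)/E → (Q⁻, Q⁺) as E → ∞, then under the ACG wiring measures ℙ_E, for every (k₀, j₀) the random variables e_{k₀j₀}/E converge in probability to Q(k₀, j₀). -/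
open scoped BigOperators Classical

/-- ACG probability of an event `A` on wirings. -/
noncomputable def acgProb (K E : ℕ) (k j : Fin E → Fin K) (Q : Fin K × Fin K → ℝ)
    (A : Equiv.Perm (Fin E) → Equiv.Perm (Fin E) → Prop) : ℝ :=
  (∑ σ : Equiv.Perm (Fin E), ∑ τ : Equiv.Perm (Fin E),
      if A σ τ then wiringWeight K E k j Q σ τ else 0) / Cnorm K E k j Q

/-- The real `H` function: `H(α; e) = ∑_{j,k} Q(k,j) exp(α⁻_j + α⁺_k) − α·e`. -/
noncomputable def Hreal (K : ℕ) (Q : Fin K × Fin K → ℝ)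
    (α e : (Fin K → ℝ) × (Fin K → ℝ)) : ℝ :=
  (∑ j : Fin K, ∑ k : Fin K, Q (k, j) * Real.exp (α.1 j + α.2 k)) -
    ((∑ j : Fin K, α.1 j * e.1 j) + ∑ k : Fin K, α.2 k * e.2 k)


lemma crit_aux (K : ℕ) (Q : Fin K × Fin K → ℝ) (hQ : ∀ p, 0 < Q p)
    (u v : Fin K → ℝ)
    (h1 : ∀ j : Fin K, ∑ k : Fin K, Q (k, j) * Real.exp (u j + v k) = ∑ k : Fin K, Q (k, j))
    (h2 : ∀ k : Fin K, ∑ j : Fin K, Q (k, j) * Real.exp (u j + v k) = ∑ j : Fin K, Q (k, j))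
    (j k : Fin K) : u j + v k = 0 := by
  have key : ∑ j : Fin K, ∑ k : Fin K,
      Q (k, j) * ((Real.exp (u j + v k) - 1) * (u j + v k)) = 0 := by
    have e1 : ∑ j : Fin K, ∑ k : Fin K, u j * (Q (k, j) * Real.exp (u j + v k) - Q (k, j)) = 0 := by
      apply Finset.sum_eq_zero
      intro j _
      rw [← Finset.mul_sum, Finset.sum_sub_distrib, h1 j]; simp
    have e2 : ∑ j : Fin K, ∑ k : Fin K, v k * (Q (k, j) * Real.exp (u j + v k) - Q (k, j)) = 0 := by
      rw [Finset.sum_comm]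
      apply Finset.sum_eq_zero
      intro k _
      rw [← Finset.mul_sum, Finset.sum_sub_distrib, h2 k]; simp
    rw [← add_zero (0 : ℝ)]
    nth_rewrite 1 [← e1]
    rw [← e2, ← Finset.sum_add_distrib]
    refine Finset.sum_congr rfl fun j _ => ?_
    rw [← Finset.sum_add_distrib]
    refine Finset.sum_congr rfl fun k _ => ?_
    ring
  have pos : ∀ t : ℝ, t ≠ 0 → 0 < (Real.exp t - 1) * t := by
    intro t ht
    rcases lt_or_gt_of_ne ht with h | h
    · have : Real.exp t < 1 := by rwa [Real.exp_lt_one_iff]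
      nlinarith
    · have := Real.one_lt_exp_iff.2 h
      nlinarith
  have nn : ∀ t : ℝ, 0 ≤ (Real.exp t - 1) * t := by
    intro t
    by_cases ht : t = 0
    · simp [ht]
    · exact (pos t ht).le
  have nn2 : ∀ j k, 0 ≤ Q (k, j) * ((Real.exp (u j + v k) - 1) * (u j + v k)) :=
    fun j k => mul_nonneg (hQ _).le (nn _)
  rw [Finset.sum_eq_zero_iff_of_nonneg (fun j _ => Finset.sum_nonneg fun k _ => nn2 j k)] at key
  have k2 := key j (Finset.mem_univ _)
  rw [Finset.sum_eq_zero_iff_of_nonneg (fun k _ => nn2 j k)] at k2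
  have k3 := k2 k (Finset.mem_univ _)
  by_contra hne
  exact (mul_pos (hQ (k, j)) (pos _ hne)).ne' k3

/-- Cross-product defect. -/
def crossF (K : ℕ) (Q x : Fin K × Fin K → ℝ) (a a' b b' : Fin K) : ℝ :=
  x (a, b) * x (a', b') * (Q (a, b') * Q (a', b)) - x (a, b') * x (a', b) * (Q (a, b) * Q (a', b'))

lemma unique_aux (K : ℕ) (Q : Fin K × Fin K → ℝ) (hQ : ∀ p, 0 < Q p)
    (x : Fin K × Fin K → ℝ) (hx : ∀ p, 0 ≤ x p)
    (h1 : ∀ j : Fin K, ∑ k : Fin K, x (k, j) = ∑ k : Fin K, Q (k, j))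
    (h2 : ∀ k : Fin K, ∑ j : Fin K, x (k, j) = ∑ j : Fin K, Q (k, j))
    (hf : ∀ a a' b b', crossF K Q x a a' b b' = 0) : x = Q := by
  have hpos : ∀ a b, 0 < x (a, b) := by
    intro a b
    by_contra hn
    have h0 : x (a, b) = 0 := le_antisymm (not_lt.1 hn) (hx _)
    obtain ⟨b', -, hb'⟩ : ∃ b' ∈ Finset.univ, 0 < x (a, b') := by
      apply Finset.exists_lt_of_sum_lt (f := fun _ => (0:ℝ))
      rw [h2 a]; simp only [Finset.sum_const_zero]
      exact Finset.sum_pos (fun i _ => hQ _) ⟨b, Finset.mem_univ _⟩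
    obtain ⟨a', -, ha'⟩ : ∃ a' ∈ Finset.univ, 0 < x (a', b) := by
      apply Finset.exists_lt_of_sum_lt (f := fun _ => (0:ℝ))
      rw [h1 b]; simp only [Finset.sum_const_zero]
      exact Finset.sum_pos (fun i _ => hQ _) ⟨a, Finset.mem_univ _⟩
    have := hf a a' b b'
    rw [crossF, h0] at this
    have h3 := mul_pos (mul_pos hb' ha') (mul_pos (hQ (a, b)) (hQ (a', b')))
    linarith
  funext ⟨a, b⟩
  let u : Fin K → ℝ := fun j => Real.log (x (a, j) / Q (a, j))
  let v : Fin K → ℝ := fun k => Real.log (x (k, b) / Q (k, b)) - Real.log (x (a, b) / Q (a, b))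
  have huv : ∀ j k, Q (k, j) * Real.exp (u j + v k) = x (k, j) := by
    intro j k
    have p1 := hQ (k, j)
    have p2 := hQ (a, j)
    have p3 := hQ (k, b)
    have p4 := hQ (a, b)
    have q2 := hpos a j
    have q3 := hpos k b
    have q4 := hpos a b
    simp only [u, v]
    rw [Real.exp_add, Real.exp_sub, Real.exp_log (div_pos q2 p2), Real.exp_log (div_pos q3 p3),
      Real.exp_log (div_pos q4 p4)]
    have := hf a k b j
    rw [crossF] at this
    field_simp
    linarith
  have h := crit_aux K Q hQ u v (fun j => by simp only [huv]; exact h1 j)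
    (fun k => by simp only [huv]; exact h2 k) b a
  have h' := huv b a
  rw [h] at h'
  simpa using h'.symm

/-- Total squared defect. -/
def defect (K : ℕ) (Q x : Fin K × Fin K → ℝ) : ℝ :=
  (∑ j : Fin K, (∑ k : Fin K, x (k, j) - ∑ k : Fin K, Q (k, j)) ^ 2) +
  (∑ k : Fin K, (∑ j : Fin K, x (k, j) - ∑ j : Fin K, Q (k, j)) ^ 2) +
  ∑ a : Fin K, ∑ a' : Fin K, ∑ b : Fin K, ∑ b' : Fin K, (crossF K Q x a a' b b') ^ 2

lemma defect_nonneg (K : ℕ) (Q x : Fin K × Fin K → ℝ) : 0 ≤ defect K Q x := by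
  unfold defect; positivity

lemma defect_pos (K : ℕ) (Q : Fin K × Fin K → ℝ) (hQ : ∀ p, 0 < Q p)
    (x : Fin K × Fin K → ℝ) (hx : ∀ p, 0 ≤ x p) (hne : x ≠ Q) : 0 < defect K Q x := by
  refine lt_of_le_of_ne (defect_nonneg K Q x) fun h0 => hne ?_
  unfold defect at h0
  have A : 0 ≤ ∑ j : Fin K, (∑ k : Fin K, x (k, j) - ∑ k : Fin K, Q (k, j)) ^ 2 := by positivity
  have B : 0 ≤ ∑ k : Fin K, (∑ j : Fin K, x (k, j) - ∑ j : Fin K, Q (k, j)) ^ 2 := by positivity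
  have C : 0 ≤ ∑ a : Fin K, ∑ a' : Fin K, ∑ b : Fin K, ∑ b' : Fin K,
    (crossF K Q x a a' b b') ^ 2 := by positivity
  have A0 : ∑ j : Fin K, (∑ k : Fin K, x (k, j) - ∑ k : Fin K, Q (k, j)) ^ 2 = 0 := by linarith
  have B0 : ∑ k : Fin K, (∑ j : Fin K, x (k, j) - ∑ j : Fin K, Q (k, j)) ^ 2 = 0 := by linarith
  have C0 : ∑ a : Fin K, ∑ a' : Fin K, ∑ b : Fin K, ∑ b' : Fin K,
    (crossF K Q x a a' b b') ^ 2 = 0 := by linarith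
  refine unique_aux K Q hQ x hx ?_ ?_ ?_
  · intro j
    rw [Finset.sum_eq_zero_iff_of_nonneg (fun _ _ => by positivity)] at A0
    have := A0 j (Finset.mem_univ _)
    exact sub_eq_zero.1 (pow_eq_zero_iff (two_ne_zero)|>.1 this)
  · intro j
    rw [Finset.sum_eq_zero_iff_of_nonneg (fun _ _ => by positivity)] at B0
    have := B0 j (Finset.mem_univ _)
    exact sub_eq_zero.1 (pow_eq_zero_iff (two_ne_zero)|>.1 this)
  · intro a a' b b'
    have z : ∀ F : Fin K → ℝ, (∀ i, 0 ≤ F i) → ∑ i, F i = 0 → ∀ i, F i = 0 := fun F hF h i =>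
      (Finset.sum_eq_zero_iff_of_nonneg (fun i _ => hF i)).1 h i (Finset.mem_univ i)
    have C1 := z _ (fun _ => Finset.sum_nonneg fun _ _ => Finset.sum_nonneg fun _ _ =>
      Finset.sum_nonneg fun _ _ => sq_nonneg _) C0 a
    have C2 := z _ (fun _ => Finset.sum_nonneg fun _ _ =>
      Finset.sum_nonneg fun _ _ => sq_nonneg _) C1 a'
    have C3 := z _ (fun _ => Finset.sum_nonneg fun _ _ => sq_nonneg _) C2 b
    have C4 := z _ (fun _ => sq_nonneg _) C3 b'
    exact (pow_eq_zero_iff (two_ne_zero)).1 C4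

lemma compact_aux (K : ℕ) (Q : Fin K × Fin K → ℝ) (hQ : ∀ p, 0 < Q p)
    (p₀ : Fin K × Fin K) (ε : ℝ) (hε : 0 < ε) :
    ∃ δ > 0, ∀ x : Fin K × Fin K → ℝ, (∀ p, 0 ≤ x p) → (∀ p, x p ≤ 1) →
      ε ≤ |x p₀ - Q p₀| → δ ≤ defect K Q x := by
  let S : Set (Fin K × Fin K → ℝ) := Set.Icc 0 1 ∩ {x | ε ≤ |x p₀ - Q p₀|}
  have hS : IsCompact S := by
    apply IsCompact.inter_right isCompact_Icc
    apply isClosed_le continuous_const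
    fun_prop
  have hc : Continuous (defect K Q) := by
    unfold defect crossF
    fun_prop
  rcases S.eq_empty_or_nonempty with h | h
  · refine ⟨1, one_pos, fun x h0 h1 h2 => ?_⟩
    have : x ∈ S := ⟨⟨h0, h1⟩, h2⟩
    simp [h] at this
  · obtain ⟨y, hy, hmin⟩ := hS.exists_isMinOn h hc.continuousOn
    refine ⟨defect K Q y, defect_pos K Q hQ y hy.1.1 ?_, fun x h0 h1 h2 => hmin ⟨⟨h0, h1⟩, h2⟩⟩
    rintro rfl
    have : ε ≤ |y p₀ - y p₀| := hy.2
    simp at this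
    linarith

/-- Indicator that edge `l` has type `(a, b)`. -/
noncomputable def ind (K E : ℕ) (k j : Fin E → Fin K) (σ τ : Equiv.Perm (Fin E))
    (a b : Fin K) (l : Fin E) : ℝ := if k (σ l) = a ∧ j (τ l) = b then 1 else 0

/-- Edge fractions. -/
noncomputable def frac (K E : ℕ) (k j : Fin E → Fin K) (σ τ : Equiv.Perm (Fin E)) :
    Fin K × Fin K → ℝ := fun p => (edgeTypeCount K E k j σ τ p.1 p.2 : ℝ) / E

lemma count_eq (K E : ℕ) (k j : Fin E → Fin K) (σ τ : Equiv.Perm (Fin E)) (a b : Fin K) :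
    (edgeTypeCount K E k j σ τ a b : ℝ) = ∑ l, ind K E k j σ τ a b l := by
  unfold edgeTypeCount ind
  rw [Finset.card_filter]
  push_cast
  exact Finset.sum_congr rfl fun l _ => by congr

lemma ind_nonneg (K E : ℕ) (k j : Fin E → Fin K) (σ τ : Equiv.Perm (Fin E)) (a b : Fin K) (l) :
    0 ≤ ind K E k j σ τ a b l := by unfold ind; split_ifs <;> simp

lemma ind_le (K E : ℕ) (k j : Fin E → Fin K) (σ τ : Equiv.Perm (Fin E)) (a b : Fin K) (l) :
    ind K E k j σ τ a b l ≤ 1 := by unfold ind; split_ifs <;> simp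

lemma frac_nonneg (K E : ℕ) (k j : Fin E → Fin K) (σ τ : Equiv.Perm (Fin E)) (p) :
    0 ≤ frac K E k j σ τ p := by unfold frac; positivity

lemma frac_le (K E : ℕ) (k j : Fin E → Fin K) (σ τ : Equiv.Perm (Fin E)) (p) :
    frac K E k j σ τ p ≤ 1 := by
  unfold frac
  apply div_le_one_of_le₀ _ (by positivity)
  unfold edgeTypeCount
  exact_mod_cast (Finset.card_le_univ _).trans (by simp)

lemma frac_row (K E : ℕ) (k j : Fin E → Fin K) (σ τ : Equiv.Perm (Fin E)) (a : Fin K) :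
    ∑ b, frac K E k j σ τ (a, b) = (stubCount K E k a : ℝ) / E := by
  unfold frac
  rw [← Finset.sum_div]
  congr 1
  simp only [count_eq]
  rw [Finset.sum_comm]
  have : ∀ l, ∑ b, ind K E k j σ τ a b l = if k (σ l) = a then 1 else 0 := by
    intro l
    unfold ind
    by_cases h : k (σ l) = a <;> simp [h]
  simp only [this]
  rw [Equiv.sum_comp σ (fun l => if k l = a then (1:ℝ) else 0)]
  simp [stubCount]

lemma frac_col (K E : ℕ) (k j : Fin E → Fin K) (σ τ : Equiv.Perm (Fin E)) (b : Fin K) :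
    ∑ a, frac K E k j σ τ (a, b) = (stubCount K E j b : ℝ) / E := by
  unfold frac
  rw [← Finset.sum_div]
  congr 1
  simp only [count_eq]
  rw [Finset.sum_comm]
  have : ∀ l, ∑ a, ind K E k j σ τ a b l = if j (τ l) = b then 1 else 0 := by
    intro l
    unfold ind
    by_cases h : j (τ l) = b <;> simp [h]
  simp only [this]
  rw [Equiv.sum_comp τ (fun l => if j l = b then (1:ℝ) else 0)]
  simp [stubCount]

lemma frac_swap (K E : ℕ) (k j : Fin E → Fin K) (σ τ : Equiv.Perm (Fin E)) (p)
    (l l' : Fin E) :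
    |frac K E k j σ (τ * Equiv.swap l l') p - frac K E k j σ τ p| ≤ 2 / E := by
  unfold frac
  rw [← sub_div, abs_div, Nat.abs_cast]
  gcongr
  rw [count_eq, count_eq, ← Finset.sum_sub_distrib]
  rw [← Finset.sum_subset (Finset.subset_univ {l, l'})]
  · refine (Finset.abs_sum_le_sum_abs _ _).trans ?_
    refine (Finset.sum_le_card_nsmul _ _ 1 ?_).trans ?_
    · intro i _
      have h1 := ind_nonneg K E k j σ τ p.1 p.2 i
      have h2 := ind_nonneg K E k j σ (τ * Equiv.swap l l') p.1 p.2 i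
      have h3 := ind_le K E k j σ τ p.1 p.2 i
      have h4 := ind_le K E k j σ (τ * Equiv.swap l l') p.1 p.2 i
      rw [abs_le]; constructor <;> linarith
    · have : Finset.card {l, l'} ≤ 2 := Finset.card_le_two
      simpa using this
  · intro i _ hi
    simp only [Finset.mem_insert, Finset.mem_singleton, not_or] at hi
    simp [ind, Equiv.swap_apply_of_ne_of_ne hi.1 hi.2]

lemma weight_swap (K E : ℕ) (k j : Fin E → Fin K) (Q : Fin K × Fin K → ℝ)
    (σ τ : Equiv.Perm (Fin E)) (a a' b b' : Fin K) (l l' : Fin E) :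
    wiringWeight K E k j Q σ (τ * Equiv.swap l l') *
      (ind K E k j σ (τ * Equiv.swap l l') a b l * ind K E k j σ (τ * Equiv.swap l l') a' b' l') *
      (Q (a, b') * Q (a', b)) =
    wiringWeight K E k j Q σ τ *
      (ind K E k j σ τ a b' l * ind K E k j σ τ a' b l') * (Q (a, b) * Q (a', b')) := by
  by_cases hc : k (σ l) = a ∧ j (τ l) = b' ∧ k (σ l') = a' ∧ j (τ l') = b
  · obtain ⟨h1, h2, h3, h4⟩ := hc
    have i1 : ind K E k j σ (τ * Equiv.swap l l') a b l = 1 := by simp [ind, h1, h4]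
    have i2 : ind K E k j σ (τ * Equiv.swap l l') a' b' l' = 1 := by simp [ind, h2, h3]
    have i3 : ind K E k j σ τ a b' l = 1 := by simp [ind, h1, h2]
    have i4 : ind K E k j σ τ a' b l' = 1 := by simp [ind, h3, h4]
    rw [i1, i2, i3, i4]
    by_cases hl : l = l'
    · subst hl
      have e1 : a = a' := h1.symm.trans h3
      have e2 : b = b' := h4.symm.trans h2
      subst e1 e2
      rw [Equiv.swap_self, show τ * Equiv.refl (Fin E) = τ from mul_one τ]
    · have split : ∀ g : Fin E → ℝ, ∏ i, g i = g l * g l' * ∏ i ∈ (Finset.univ.erase l).erase l', g i := by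
        intro g
        rw [mul_assoc, Finset.mul_prod_erase _ _ (by simp [Ne.symm hl]),
          Finset.mul_prod_erase _ _ (Finset.mem_univ _)]
      unfold wiringWeight
      rw [split, split (fun i => Q (k (σ i), j (τ i)))]
      have : ∏ i ∈ (Finset.univ.erase l).erase l', Q (k (σ i), j ((τ * Equiv.swap l l') i)) =
          ∏ i ∈ (Finset.univ.erase l).erase l', Q (k (σ i), j (τ i)) := by
        refine Finset.prod_congr rfl fun i hi => ?_
        simp only [Finset.mem_erase, Finset.mem_univ, and_true] at hi
        simp [Equiv.swap_apply_of_ne_of_ne hi.2 hi.1]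
      rw [this]
      simp only [Equiv.Perm.mul_apply, Equiv.swap_apply_left, Equiv.swap_apply_right, h1, h2, h3, h4]
      ring
  · have z1 : ind K E k j σ (τ * Equiv.swap l l') a b l *
        ind K E k j σ (τ * Equiv.swap l l') a' b' l' = 0 := by
      simp only [ind, Equiv.Perm.mul_apply, Equiv.swap_apply_left, Equiv.swap_apply_right]
      rw [mul_eq_zero]
      by_contra hcon
      push Not at hcon
      simp only [ne_eq, ite_eq_right_iff, one_ne_zero, imp_false, not_not] at hcon
      tauto
    have z2 : ind K E k j σ τ a b' l * ind K E k j σ τ a' b l' = 0 := by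
      simp only [ind]
      rw [mul_eq_zero]
      by_contra hcon
      push Not at hcon
      simp only [ne_eq, ite_eq_right_iff, one_ne_zero, imp_false, not_not] at hcon
      tauto
    rw [z1, z2]; simp

lemma weight_nonneg (K E : ℕ) (k j : Fin E → Fin K) (Q : Fin K × Fin K → ℝ)
    (hQ : ∀ p, 0 < Q p) (σ τ : Equiv.Perm (Fin E)) : 0 < wiringWeight K E k j Q σ τ :=
  Finset.prod_pos fun _ _ => hQ _

lemma crossF_swap (K E : ℕ) (k j : Fin E → Fin K) (Q : Fin K × Fin K → ℝ)
    (hQ : ∀ p, 0 < Q p) (hQ1 : ∀ p, Q p ≤ 1) (σ τ : Equiv.Perm (Fin E)) (a a' b b' : Fin K)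
    (l l' : Fin E) :
    |crossF K Q (frac K E k j σ (τ * Equiv.swap l l')) a a' b b' -
      crossF K Q (frac K E k j σ τ) a a' b b'| ≤ 8 / E := by
  have prodb : ∀ p q, |frac K E k j σ (τ * Equiv.swap l l') p * frac K E k j σ (τ * Equiv.swap l l') q -
      frac K E k j σ τ p * frac K E k j σ τ q| ≤ 4 / E := by
    intro p q
    have h1 := frac_swap K E k j σ τ p l l'
    have h2 := frac_swap K E k j σ τ q l l'
    have n1 := frac_nonneg K E k j σ (τ * Equiv.swap l l') p
    have n2 := frac_nonneg K E k j σ τ q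
    have m1 := frac_le K E k j σ (τ * Equiv.swap l l') p
    have m2 := frac_le K E k j σ τ q
    generalize frac K E k j σ (τ * Equiv.swap l l') p = x' at *
    generalize frac K E k j σ (τ * Equiv.swap l l') q = y' at *
    generalize frac K E k j σ τ p = x at *
    generalize frac K E k j σ τ q = y at *
    have e : x' * y' - x * y = x' * (y' - y) + (x' - x) * y := by ring
    rw [e]
    refine (abs_add_le _ _).trans ?_
    rw [abs_mul, abs_mul, abs_of_nonneg n1, abs_of_nonneg n2]
    have : (4:ℝ) / E = 2 / E + 2 / E := by ring
    rw [this]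
    have a1 := abs_nonneg (y' - y)
    have a2 := abs_nonneg (x' - x)
    apply add_le_add <;> nlinarith
  have h1 := prodb (a, b) (a', b')
  have h2 := prodb (a, b') (a', b)
  have c1 : Q (a, b') * Q (a', b) ≤ 1 := mul_le_one₀ (hQ1 _) (hQ _).le (hQ1 _)
  have c2 : Q (a, b) * Q (a', b') ≤ 1 := mul_le_one₀ (hQ1 _) (hQ _).le (hQ1 _)
  have d1 : 0 < Q (a, b') * Q (a', b) := mul_pos (hQ _) (hQ _)
  have d2 : 0 < Q (a, b) * Q (a', b') := mul_pos (hQ _) (hQ _)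
  unfold crossF
  generalize Q (a, b') * Q (a', b) = c at *
  generalize Q (a, b) * Q (a', b') = d at *
  generalize frac K E k j σ (τ * Equiv.swap l l') (a, b) *
    frac K E k j σ (τ * Equiv.swap l l') (a', b') = X' at *
  generalize frac K E k j σ (τ * Equiv.swap l l') (a, b') *
    frac K E k j σ (τ * Equiv.swap l l') (a', b) = Y' at *
  generalize frac K E k j σ τ (a, b) * frac K E k j σ τ (a', b') = X at *
  generalize frac K E k j σ τ (a, b') * frac K E k j σ τ (a', b) = Y at *
  have e : X' * c - Y' * d - (X * c - Y * d) = (X' - X) * c - (Y' - Y) * d := by ring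
  rw [e]
  refine (abs_sub _ _).trans ?_
  rw [abs_mul, abs_mul, abs_of_pos d1, abs_of_pos d2]
  have : (8:ℝ) / E = 4 / E + 4 / E := by ring
  rw [this]
  have a1 := abs_nonneg (X' - X)
  have a2 := abs_nonneg (Y' - Y)
  apply add_le_add <;> nlinarith

lemma frac_prod (K E : ℕ) (k j : Fin E → Fin K) (σ τ : Equiv.Perm (Fin E)) (a a' b b' : Fin K) :
    frac K E k j σ τ (a, b) * frac K E k j σ τ (a', b') =
      (∑ l, ∑ l', ind K E k j σ τ a b l * ind K E k j σ τ a' b' l') / (E : ℝ) ^ 2 := by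
  unfold frac
  rw [count_eq, count_eq, div_mul_div_comm, Finset.sum_mul_sum, sq]

lemma second_moment (K E : ℕ) (hE : 0 < E) (k j : Fin E → Fin K) (Q : Fin K × Fin K → ℝ)
    (hQ : ∀ p, 0 < Q p) (hQ1 : ∀ p, Q p ≤ 1) (σ : Equiv.Perm (Fin E)) (a a' b b' : Fin K) :
    ∑ τ, wiringWeight K E k j Q σ τ * (crossF K Q (frac K E k j σ τ) a a' b b') ^ 2 ≤
      8 / E * ∑ τ, wiringWeight K E k j Q σ τ := by
  have hE' : (0:ℝ) < E := by exact_mod_cast hE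
  set w := fun τ => wiringWeight K E k j Q σ τ with hw
  set g := fun τ => crossF K Q (frac K E k j σ τ) a a' b b' with hg
  set I := fun τ l l' => ind K E k j σ τ a b l * ind K E k j σ τ a' b' l' with hI
  set J := fun τ l l' => ind K E k j σ τ a b' l * ind K E k j σ τ a' b l' with hJ
  set c := Q (a, b') * Q (a', b) with hc
  set d := Q (a, b) * Q (a', b') with hd
  have d1 : d ≤ 1 := mul_le_one₀ (hQ1 _) (hQ _).le (hQ1 _)
  have d0 : 0 < d := mul_pos (hQ _) (hQ _)
  have hgI : ∀ τ, g τ = (∑ l, ∑ l', (I τ l l' * c - J τ l l' * d)) / (E : ℝ) ^ 2 := by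
    intro τ
    simp only [hg, crossF]
    rw [frac_prod, frac_prod]
    simp only [Finset.sum_sub_distrib, ← Finset.sum_mul]
    ring
  have hsw : ∀ l l', ∑ τ, w τ * I τ l l' * c * g τ =
      ∑ τ, w τ * J τ l l' * d * g (τ * Equiv.swap l l') := by
    intro l l'
    rw [← Equiv.sum_comp (Equiv.mulRight (Equiv.swap l l'))]
    refine Finset.sum_congr rfl fun τ _ => ?_
    have := weight_swap K E k j Q σ τ a a' b b' l l'
    simp only [Equiv.coe_mulRight]
    rw [show w (τ * Equiv.swap l l') * I (τ * Equiv.swap l l') l l' * c = w τ * J τ l l' * d from this]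
  have h1 : ∑ τ, w τ * g τ ^ 2 =
      (∑ l, ∑ l', ∑ τ, w τ * J τ l l' * d * (g (τ * Equiv.swap l l') - g τ)) / (E : ℝ) ^ 2 := by
    have h2 : ∀ l l', ∑ τ, w τ * J τ l l' * d * (g (τ * Equiv.swap l l') - g τ) =
        ∑ τ, w τ * g τ * (I τ l l' * c - J τ l l' * d) := by
      intro l l'
      simp only [mul_sub, Finset.sum_sub_distrib]
      rw [← hsw]
      congr 1 <;> exact Finset.sum_congr rfl fun τ _ => by ring
    simp only [h2]
    have h3 : ∀ τ, w τ * g τ ^ 2 =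
        (∑ l, ∑ l', w τ * g τ * (I τ l l' * c - J τ l l' * d)) / (E : ℝ) ^ 2 := by
      intro τ
      simp only [← Finset.mul_sum]
      rw [mul_div_assoc, ← hgI]; ring
    rw [Finset.sum_congr rfl fun τ _ => h3 τ, ← Finset.sum_div, Finset.sum_comm]
    congr 1
    refine Finset.sum_congr rfl fun l _ => ?_
    rw [Finset.sum_comm]
  rw [show (∑ τ, wiringWeight K E k j Q σ τ * (crossF K Q (frac K E k j σ τ) a a' b b') ^ 2) =
    ∑ τ, w τ * g τ ^ 2 from rfl, h1, div_le_iff₀ (by positivity)]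
  have hb : ∀ l l', ∑ τ, w τ * J τ l l' * d * (g (τ * Equiv.swap l l') - g τ) ≤
      8 / E * ∑ τ, w τ := by
    intro l l'
    rw [Finset.mul_sum]
    refine Finset.sum_le_sum fun τ _ => ?_
    have w0 : 0 < w τ := weight_nonneg K E k j Q hQ σ τ
    have j0 : 0 ≤ J τ l l' := mul_nonneg (ind_nonneg ..) (ind_nonneg ..)
    have j1 : J τ l l' ≤ 1 := mul_le_one₀ (ind_le ..) (ind_nonneg ..) (ind_le ..)
    have hs : g (τ * Equiv.swap l l') - g τ ≤ 8 / E :=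
      (le_abs_self _).trans (crossF_swap K E k j Q hQ hQ1 σ τ a a' b b' l l')
    have jd : J τ l l' * d ≤ 1 := mul_le_one₀ j1 d0.le d1
    calc w τ * J τ l l' * d * (g (τ * Equiv.swap l l') - g τ)
        ≤ w τ * J τ l l' * d * (8 / E) := by gcongr
      _ = (8 / E) * (w τ * (J τ l l' * d)) := by ring
      _ ≤ (8 / E) * (w τ * 1) := by gcongr
      _ = _ := by ring
  calc _ ≤ ∑ l : Fin E, ∑ l' : Fin E, 8 / (E:ℝ) * ∑ τ, w τ :=
        Finset.sum_le_sum fun l _ => Finset.sum_le_sum fun l' _ => hb l l'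
    _ = _ := by simp; ring

lemma prob_bound (K E : ℕ) (hE : 0 < E) (k j : Fin E → Fin K) (Q : Fin K × Fin K → ℝ)
    (hQ : ∀ p, 0 < Q p) (hQ1 : ∀ p, Q p ≤ 1) (A : Equiv.Perm (Fin E) → Equiv.Perm (Fin E) → Prop)
    (δ : ℝ) (hδ : 0 < δ) (hA : ∀ σ τ, A σ τ → δ ≤ defect K Q (frac K E k j σ τ)) :
    acgProb K E k j Q A ≤
      ((∑ b : Fin K, ((stubCount K E j b : ℝ) / E - ∑ k : Fin K, Q (k, b)) ^ 2) +
      (∑ a : Fin K, ((stubCount K E k a : ℝ) / E - ∑ j : Fin K, Q (a, j)) ^ 2) +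
      (K : ℝ) ^ 4 * (8 / E)) / δ := by
  have hC : 0 < Cnorm K E k j Q :=
    Finset.sum_pos (fun σ _ => Finset.sum_pos (fun τ _ => weight_nonneg K E k j Q hQ σ τ)
      Finset.univ_nonempty) Finset.univ_nonempty
  unfold acgProb
  rw [div_le_div_iff₀ hC hδ]
  set M := (∑ b : Fin K, ((stubCount K E j b : ℝ) / E - ∑ k : Fin K, Q (k, b)) ^ 2) +
      (∑ a : Fin K, ((stubCount K E k a : ℝ) / E - ∑ j : Fin K, Q (a, j)) ^ 2) with hM
  have hdef : ∀ σ τ, defect K Q (frac K E k j σ τ) = M +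
      ∑ a : Fin K, ∑ a' : Fin K, ∑ b : Fin K, ∑ b' : Fin K,
        (crossF K Q (frac K E k j σ τ) a a' b b') ^ 2 := by
    intro σ τ
    simp only [defect, frac_row, frac_col, hM]
  have h1 : (∑ σ : Equiv.Perm (Fin E), ∑ τ : Equiv.Perm (Fin E),
      if A σ τ then wiringWeight K E k j Q σ τ else 0) * δ ≤
      ∑ σ : Equiv.Perm (Fin E), ∑ τ : Equiv.Perm (Fin E),
        wiringWeight K E k j Q σ τ * defect K Q (frac K E k j σ τ) := by
    rw [Finset.sum_mul]
    refine Finset.sum_le_sum fun σ _ => ?_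
    rw [Finset.sum_mul]
    refine Finset.sum_le_sum fun τ _ => ?_
    have w0 := weight_nonneg K E k j Q hQ σ τ
    split_ifs with h
    · exact mul_le_mul_of_nonneg_left (hA σ τ h) w0.le
    · rw [zero_mul]; exact mul_nonneg w0.le (defect_nonneg _ _ _)
  refine h1.trans ?_
  rw [Cnorm, Finset.mul_sum]
  refine Finset.sum_le_sum fun σ _ => ?_
  simp only [hdef, mul_add, Finset.sum_add_distrib, add_mul]
  rw [← Finset.sum_mul, mul_comm]
  refine add_le_add le_rfl ?_
  simp only [Finset.mul_sum]
  have swap4 : ∀ F : Equiv.Perm (Fin E) → Fin K → Fin K → Fin K → Fin K → ℝ,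
      ∑ τ, ∑ a, ∑ a', ∑ b, ∑ b', F τ a a' b b' = ∑ a, ∑ a', ∑ b, ∑ b', ∑ τ, F τ a a' b b' := by
    intro F
    rw [Finset.sum_comm]
    refine Finset.sum_congr rfl fun a _ => ?_
    rw [Finset.sum_comm]
    refine Finset.sum_congr rfl fun a' _ => ?_
    rw [Finset.sum_comm]
    refine Finset.sum_congr rfl fun b _ => ?_
    rw [Finset.sum_comm]
  rw [swap4]
  calc _ ≤ ∑ a : Fin K, ∑ a' : Fin K, ∑ b : Fin K, ∑ b' : Fin K,
        8 / (E:ℝ) * ∑ τ, wiringWeight K E k j Q σ τ :=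
        Finset.sum_le_sum fun a _ => Finset.sum_le_sum fun a' _ => Finset.sum_le_sum fun b _ =>
          Finset.sum_le_sum fun b' _ => second_moment K E hE k j Q hQ hQ1 σ a a' b b'
    _ = _ := by
      simp only [Finset.sum_const, Finset.card_univ, Fintype.card_fin, nsmul_eq_mul, Finset.mul_sum]
      refine Finset.sum_congr rfl fun τ _ => ?_
      ring

/-- For a probability weight matrix `Q > 0` with marginals `(Q⁻, Q⁺)`:
(i) `α = 0` is the unique critical point of `H(·; (Q⁻,Q⁺))` with `𝟏̃·α = 0`, and
`H(0; (Q⁻,Q⁺)) = 1`; (ii) if the stub margins satisfy `e(E)/E → (Q⁻, Q⁺)`, then under the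
ACG wiring measures the fractions `e_{k₀j₀}/E` converge in probability to `Q(k₀,j₀)`. -/
theorem stmt14 (K : ℕ) (hK : 1 ≤ K) (Q : Fin K × Fin K → ℝ) (hQ : ∀ p, 0 < Q p)
    (hQsum : ∑ j : Fin K, ∑ k : Fin K, Q (k, j) = 1)
    (kdeg jdeg : (E : ℕ) → Fin E → Fin K)
    (hconv : Filter.Tendsto
      (fun E : ℕ => ((fun j' => (stubCount K E (jdeg E) j' : ℝ) / E,
          fun k' => (stubCount K E (kdeg E) k' : ℝ) / E) : (Fin K → ℝ) × (Fin K → ℝ)))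
      Filter.atTop
      (nhds ((fun j' => ∑ k : Fin K, Q (k, j'), fun k' => ∑ j : Fin K, Q (k', j)) :
        (Fin K → ℝ) × (Fin K → ℝ)))) :
    (∀ α : (Fin K → ℝ) × (Fin K → ℝ),
      ((∑ j : Fin K, α.1 j = ∑ k : Fin K, α.2 k) ∧
        (∀ j : Fin K, ∑ k : Fin K, Q (k, j) * Real.exp (α.1 j + α.2 k) = ∑ k : Fin K, Q (k, j)) ∧
        (∀ k : Fin K, ∑ j : Fin K, Q (k, j) * Real.exp (α.1 j + α.2 k) = ∑ j : Fin K, Q (k, j)))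
        ↔ α = 0) ∧
    Hreal K Q 0 (fun j' => ∑ k : Fin K, Q (k, j'), fun k' => ∑ j : Fin K, Q (k', j)) = 1 ∧
    (∀ (k₀ j₀ : Fin K) (ε : ℝ), 0 < ε →
      Filter.Tendsto
        (fun E : ℕ => acgProb K E (kdeg E) (jdeg E) Q (fun σ τ =>
          |(edgeTypeCount K E (kdeg E) (jdeg E) σ τ k₀ j₀ : ℝ) / E - Q (k₀, j₀)| > ε))
        Filter.atTop (nhds 0)) := by
  have hQ1 : ∀ p, Q p ≤ 1 := by
    rintro ⟨a, b⟩
    rw [← hQsum]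
    calc Q (a, b) ≤ ∑ k, Q (k, b) :=
          Finset.single_le_sum (f := fun k => Q (k, b)) (fun i _ => (hQ _).le) (Finset.mem_univ a)
      _ ≤ _ := Finset.single_le_sum (f := fun j => ∑ k, Q (k, j))
          (fun i _ => Finset.sum_nonneg fun k _ => (hQ _).le) (Finset.mem_univ b)
  refine ⟨?_, ?_, ?_⟩
  · rintro ⟨u, v⟩
    constructor
    · rintro ⟨h0, h1, h2⟩
      have h := crit_aux K Q hQ u v h1 h2
      have i0 : Fin K := ⟨0, hK⟩
      have hu : ∀ j, u j = - v i0 := fun j => by linarith [h j i0]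
      have hv : ∀ k, v k = v i0 := fun k => by linarith [h i0 k, h i0 i0]
      simp only [hu] at h0
      rw [Finset.sum_congr rfl fun k _ => hv k] at h0
      simp only [Finset.sum_const, Finset.card_univ, Fintype.card_fin, nsmul_eq_mul] at h0
      have hK' : (0:ℝ) < K := by exact_mod_cast hK
      have hz : v i0 = 0 := by
        have : (K:ℝ) * v i0 = 0 := by linarith
        rcases mul_eq_zero.1 this with h | h
        · exact absurd h hK'.ne'
        · exact h
      ext i
      · simp [hu i, hz]
      · simp [hv i, hz]
    · intro h
      obtain ⟨rfl, rfl⟩ := Prod.mk.inj h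
      simp
  · simp [Hreal, hQsum]
  · intro k₀ j₀ ε hε
    obtain ⟨δ, hδ, hd⟩ := compact_aux K Q hQ (k₀, j₀) ε hε
    have t1 : ∀ b, Filter.Tendsto (fun E : ℕ => (stubCount K E (jdeg E) b : ℝ) / E) Filter.atTop
        (nhds (∑ k : Fin K, Q (k, b))) := fun b =>
      (tendsto_pi_nhds.1 ((Prod.tendsto_iff _ _).1 hconv).1) b
    have t2 : ∀ a, Filter.Tendsto (fun E : ℕ => (stubCount K E (kdeg E) a : ℝ) / E) Filter.atTop
        (nhds (∑ j : Fin K, Q (a, j))) := fun a =>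
      (tendsto_pi_nhds.1 ((Prod.tendsto_iff _ _).1 hconv).2) a
    have t3 : Filter.Tendsto (fun E : ℕ => (8:ℝ) / E) Filter.atTop (nhds 0) :=
      tendsto_const_div_atTop_nhds_zero_nat 8
    have T := ((((tendsto_finsetSum Finset.univ fun b _ =>
        ((t1 b).sub_const (∑ k : Fin K, Q (k, b))).pow 2).add
      (tendsto_finsetSum Finset.univ fun a _ =>
        ((t2 a).sub_const (∑ j : Fin K, Q (a, j))).pow 2)).add
      (t3.const_mul ((K:ℝ) ^ 4))).div_const δ)
    simp only [sub_self, ne_eq, OfNat.ofNat_ne_zero, not_false_eq_true, zero_pow,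
      Finset.sum_const_zero, add_zero, mul_zero, zero_div] at T
    refine tendsto_of_tendsto_of_tendsto_of_le_of_le' tendsto_const_nhds T ?_ ?_
    · refine Filter.Eventually.of_forall fun E => ?_
      have w0 := fun σ τ => (weight_nonneg K E (kdeg E) (jdeg E) Q hQ σ τ).le
      refine div_nonneg (Finset.sum_nonneg fun σ _ => Finset.sum_nonneg fun τ _ => ?_)
        (Finset.sum_nonneg fun σ _ => Finset.sum_nonneg fun τ _ => w0 σ τ)
      split_ifs
      · exact w0 σ τ
      · exact le_rfl
    · filter_upwards [Filter.eventually_gt_atTop 0] with E hE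
      refine prob_bound K E hE (kdeg E) (jdeg E) Q hQ hQ1 _ δ hδ fun σ τ h => ?_
      exact hd _ (frac_nonneg K E (kdeg E) (jdeg E) σ τ) (frac_le K E (kdeg E) (jdeg E) σ τ) (le_of_lt h)
end
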